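/- arXiv:2604.14308 — 3 statements merged into one kernel-verified Lean document; each statement's English description precedes it below -/
import Mathlib

section
/- Let α : ℝ → ℝ be locally Lipschitz with α(0) = 0, let T ∈ (0, ∞], and let y : [0, T) → ℝ be differentiable with y′(t) ≥ −α(y(t)) for all t ∈ [0, T). If y(0) ≥ 0, then y(t) ≥ 0 for all t ∈ [0, T). -/
/-- scalar comparison principle underlying forward invariance of zero
superlevel sets: if `α` is locally Lipschitz with `α 0 = 0`, `y` is differentiable on
`[0, T)` with `y' t ≥ -α (y t)` there, and `y 0 ≥ 0`, then `y t ≥ 0` on `[0, T)`. -/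
theorem stmt_0 (α : ℝ → ℝ) (hα : LocallyLipschitz α) (hα0 : α 0 = 0)
    (T : EReal) (hT : 0 < T) (y y' : ℝ → ℝ)
    (hderiv : ∀ t : ℝ, 0 ≤ t → (t : EReal) < T → HasDerivAt y (y' t) t)
    (hineq : ∀ t : ℝ, 0 ≤ t → (t : EReal) < T → y' t ≥ -α (y t))
    (h0 : y 0 ≥ 0) :
    ∀ t : ℝ, 0 ≤ t → (t : EReal) < T → y t ≥ 0 := by
  intro t ht htT
  by_contra! hneg
  obtain ⟨K, s, hs, hK⟩ := hα 0
  obtain ⟨δ, hδ, hball⟩ := Metric.mem_nhds_iff.1 hs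
  have hlt : ∀ x ∈ Set.Icc 0 t, (x : EReal) < T := fun x hx =>
    (EReal.coe_le_coe_iff.2 hx.2).trans_lt htT
  obtain ⟨c, hc, hcδ, hct⟩ : ∃ c : ℝ, 0 < c ∧ c < δ ∧ c < -y t := by
    obtain ⟨c, hc, hc'⟩ := exists_between (lt_min hδ (neg_pos.2 hneg))
    exact ⟨c, hc, hc'.trans_le (min_le_left _ _), hc'.trans_le (min_le_right _ _)⟩
  -- `-y` stays below a barrier `B` whose growth rate `K + 1` exceeds the Lipschitz constant of `α`.
  let B : ℝ → ℝ := fun x => c * Real.exp ((K + 1) * (x - t))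
  have hBpos : ∀ x, 0 < B x := fun x => mul_pos hc (Real.exp_pos _)
  have hB : ∀ x, HasDerivAt B ((K + 1) * B x) x := fun x => by
    refine ((((hasDerivAt_id x).sub_const t).const_mul ((K : ℝ) + 1)).exp.const_mul c).congr_deriv ?_
    simp only [B, id]
    ring
  have key := image_le_of_deriv_right_lt_deriv_boundary (f := fun x => -y x)
    (f' := fun x => -y' x) (a := 0) (b := t)
    (fun x hx => (hderiv x hx.1 (hlt x hx)).continuousAt.neg.continuousWithinAt)
    (fun x hx => (hderiv x hx.1 (hlt x ⟨hx.1, hx.2.le⟩)).neg.hasDerivWithinAt)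
    (B := B) (by linarith [hBpos 0]) hB (fun x hx hxB => ?_) ⟨ht, le_rfl⟩
  · simp only [B, sub_self, mul_zero, Real.exp_zero, mul_one] at key
    linarith
  · have hBδ : B x < δ := by
      refine (mul_le_of_le_one_right hc.le (Real.exp_le_one_iff.2 ?_)).trans_lt hcδ
      exact mul_nonpos_of_nonneg_of_nonpos (by positivity) (sub_nonpos.2 hx.2.le)
    have habs : |y x| = B x := by rw [← abs_neg, hxB, abs_of_pos (hBpos x)]
    have hmem : y x ∈ s := hball (by rwa [mem_ball_zero_iff, Real.norm_eq_abs, habs])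
    have hlip := hK.dist_le_mul _ hmem _ (mem_of_mem_nhds hs)
    rw [hα0, Real.dist_0_eq_abs, Real.dist_0_eq_abs, habs] at hlip
    linarith [le_abs_self (α (y x)), hineq x hx.1 (hlt x ⟨hx.1, hx.2.le⟩), hBpos x]
end

section
/- Let f_cl : ℝⁿ → ℝⁿ be locally Lipschitz, let h : ℝⁿ → ℝ be continuously differentiable, and let α : ℝ → ℝ be locally Lipschitz, strictly increasing, with α(0) = 0. Suppose the barrier condition ∇h(x) ⋅ f_cl(x) ≥ −α(h(x)) holds for all x ∈ ℝⁿ. Let T ∈ (0, ∞] and let x : [0, T) → ℝⁿ be differentiable with x′(t) = f_cl(x(t)) for all t ∈ [0, T). If h(x(0)) ≥ 0, then h(x(t)) ≥ 0 for all t ∈ [0, T). -/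
/-- A function which is nonnegative at `a` and has positive derivative wherever it is negative
stays nonnegative on `[a, b]`. -/
theorem nonneg_of_hasDerivAt_pos_of_neg {g g' : ℝ → ℝ} {a b : ℝ}
    (hg : ∀ t ∈ Set.Icc a b, HasDerivAt g (g' t) t) (ha : 0 ≤ g a)
    (hpos : ∀ t ∈ Set.Icc a b, g t < 0 → 0 < g' t) :
    ∀ t ∈ Set.Icc a b, 0 ≤ g t := by
  intro t ht
  refine le_of_forall_pos_le_add fun ε hε => ?_
  have key : -g t ≤ ε :=
    image_le_of_deriv_right_lt_deriv_boundary (f := fun s => -g s) (f' := fun s => -g' s)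
      (B := fun _ => ε) (B' := fun _ => 0)
      (fun s hs => (hg s hs).neg.continuousAt.continuousWithinAt)
      (fun s hs => (hg s (Set.Ico_subset_Icc_self hs)).neg.hasDerivWithinAt)
      (by linarith) (fun s => hasDerivAt_const s ε)
      (fun s hs hsε => neg_neg_of_pos
        (hpos s (Set.Ico_subset_Icc_self hs) (by linarith))) ht
  linarith


/-- a barrier function `h` (with extended class-K∞, locally Lipschitz `α`
satisfying the barrier condition `∇h(x) ⋅ f_cl(x) ≥ -α (h x)`) renders the zero
superlevel set of `h` forward invariant along solutions of `ẋ = f_cl(x)`. -/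
theorem stmt_1 {n : ℕ}
    (f_cl : (Fin n → ℝ) → (Fin n → ℝ)) (hf : LocallyLipschitz f_cl)
    (h : (Fin n → ℝ) → ℝ) (hh : ContDiff ℝ 1 h)
    (α : ℝ → ℝ) (hα : LocallyLipschitz α) (hmono : StrictMono α) (hα0 : α 0 = 0)
    (hbar : ∀ x : Fin n → ℝ, fderiv ℝ h x (f_cl x) ≥ -α (h x))
    (T : EReal) (hT : 0 < T) (x : ℝ → (Fin n → ℝ))
    (hx : ∀ t : ℝ, 0 ≤ t → (t : EReal) < T → HasDerivAt x (f_cl (x t)) t)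
    (h0 : h (x 0) ≥ 0) :
    ∀ t : ℝ, 0 ≤ t → (t : EReal) < T → h (x t) ≥ 0 := by
  intro t ht htT
  have hlt : ∀ s ∈ Set.Icc 0 t, (s : EReal) < T := fun s hs =>
    (EReal.coe_le_coe_iff.2 hs.2).trans_lt htT
  refine nonneg_of_hasDerivAt_pos_of_neg (g := h ∘ x)
    (g' := fun s => fderiv ℝ h (x s) (f_cl (x s))) (fun s hs => ?_) h0 (fun s _ hneg => ?_)
    t ⟨ht, le_rfl⟩
  · exact (hh.differentiable one_ne_zero (x s)).hasFDerivAt.comp_hasDerivAt s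
      (hx s hs.1 (hlt s hs))
  · have hα_neg : α (h (x s)) < 0 := hα0 ▸ hmono hneg
    linarith [hbar (x s)]
end

section
/- Let f : ℝⁿ → ℝⁿ, G : ℝⁿ → ℝ^{n×m}, Φ : ℝⁿ → ℝ^{m×p} be continuous, h : ℝⁿ → ℝ continuously differentiable, θ ∈ ℝᵖ, and Γ ∈ ℝ^{p×p} symmetric positive definite. Define ψ(x) := (∇h(x)ᵀ G(x) Φ(x))ᵀ ∈ ℝᵖ and h_a(x, θ̂) := h(x) − ½ (θ − θ̂)ᵀ Γ⁻¹ (θ − θ̂). Let T ∈ (0, ∞], and let x : [0, T) → ℝⁿ, θ̂ : [0, T) → ℝᵖ, u : [0, T) → ℝᵐ be such that x, θ̂ are differentiable with x′(t) = f(x(t)) + G(x(t))(u(t) + Φ(x(t)) θ) and θ̂′(t) = −Γ ψ(x(t)) for all t ∈ [0, T). Then for all t ∈ [0, T), d/dt [h_a(x(t), θ̂(t))] = ∇h(x(t)) ⋅ ( f(x(t)) + G(x(t))(u(t) + Φ(x(t)) θ̂(t)) ); that is, along the adaptive closed loop with update law θ̂̇ = −Γψ(x), the true unknown parameter θ is exactly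 replaced by the estimate θ̂ in the derivative of the augmented barrier candidate. -/
open Matrix

/-- `ψ(x) := (∇h(x)ᵀ G(x) Φ(x))ᵀ ∈ ℝᵖ`: the `j`-th entry is the directional derivative
of `h` at `x` along the `j`-th column of `G(x) Φ(x)`. -/
noncomputable def psi {n m p : ℕ} (h : (Fin n → ℝ) → ℝ)
    (G : (Fin n → ℝ) → Matrix (Fin n) (Fin m) ℝ)
    (Φ : (Fin n → ℝ) → Matrix (Fin m) (Fin p) ℝ)
    (x : Fin n → ℝ) : Fin p → ℝ :=
  fun j => fderiv ℝ h x (fun i => (G x * Φ x) i j)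

/-- Augmented barrier candidate `h_a(x, θ̂) := h(x) - ½ (θ - θ̂)ᵀ Γ⁻¹ (θ - θ̂)`. -/
noncomputable def hA {n p : ℕ} (h : (Fin n → ℝ) → ℝ) (θ : Fin p → ℝ)
    (Γ : Matrix (Fin p) (Fin p) ℝ) (x : Fin n → ℝ) (θhat : Fin p → ℝ) : ℝ :=
  h x - (1 / 2) * ((θ - θhat) ⬝ᵥ (Γ⁻¹ *ᵥ (θ - θhat)))

theorem fderiv_mulVec_eq_psi_dotProduct {n m p : ℕ} (h : (Fin n → ℝ) → ℝ)
    (G : (Fin n → ℝ) → Matrix (Fin n) (Fin m) ℝ)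
    (Φ : (Fin n → ℝ) → Matrix (Fin m) (Fin p) ℝ) (x : Fin n → ℝ) (v : Fin p → ℝ) :
    fderiv ℝ h x (G x *ᵥ (Φ x *ᵥ v)) = psi h G Φ x ⬝ᵥ v := by
  have hv : G x *ᵥ (Φ x *ᵥ v) = ∑ j, v j • fun i => (G x * Φ x) i j := by
    rw [mulVec_mulVec]
    ext i
    simp [mulVec, dotProduct, mul_comm]
  rw [hv, map_sum]
  simp [psi, dotProduct, mul_comm]

theorem HasDerivAt.dotProduct {ι : Type*} [Fintype ι] {a b : ℝ → ι → ℝ} {a' b' : ι → ℝ} {t : ℝ}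
    (ha : HasDerivAt a a' t) (hb : HasDerivAt b b' t) :
    HasDerivAt (fun τ => a τ ⬝ᵥ b τ) (a' ⬝ᵥ b t + a t ⬝ᵥ b') t := by
  simp only [_root_.dotProduct, ← Finset.sum_add_distrib]
  exact HasDerivAt.fun_sum fun i _ => (hasDerivAt_pi.1 ha i).mul (hasDerivAt_pi.1 hb i)

theorem HasDerivAt.const_mulVec {ι κ : Type*} [Fintype ι] [Fintype κ] (A : Matrix κ ι ℝ)
    {a : ℝ → ι → ℝ} {a' : ι → ℝ} {t : ℝ} (ha : HasDerivAt a a' t) :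
    HasDerivAt (fun τ => A *ᵥ a τ) (A *ᵥ a') t :=
  (LinearMap.toContinuousLinearMap A.mulVecLin).hasFDerivAt.comp_hasDerivAt t ha

/-- along the adaptive closed loop with update law `θ̂' = -Γ ψ(x)`, the
derivative of the augmented barrier candidate equals the nominal barrier derivative with
the true parameter `θ` exactly replaced by the estimate `θ̂`. -/
theorem stmt_2 {n m p : ℕ}
    (f : (Fin n → ℝ) → (Fin n → ℝ))
    (G : (Fin n → ℝ) → Matrix (Fin n) (Fin m) ℝ)
    (Φ : (Fin n → ℝ) → Matrix (Fin m) (Fin p) ℝ)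
    (hf : Continuous f) (hG : Continuous G) (hΦ : Continuous Φ)
    (h : (Fin n → ℝ) → ℝ) (hh : ContDiff ℝ 1 h)
    (θ : Fin p → ℝ) (Γ : Matrix (Fin p) (Fin p) ℝ) (hΓ : Γ.PosDef)
    (T : EReal) (hT : 0 < T)
    (x : ℝ → Fin n → ℝ) (θhat : ℝ → Fin p → ℝ) (u : ℝ → Fin m → ℝ)
    (hx : ∀ t : ℝ, 0 ≤ t → (t : EReal) < T →
      HasDerivAt x (f (x t) + G (x t) *ᵥ (u t + Φ (x t) *ᵥ θ)) t)
    (hθhat : ∀ t : ℝ, 0 ≤ t → (t : EReal) < T →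
      HasDerivAt θhat (-(Γ *ᵥ psi h G Φ (x t))) t) :
    ∀ t : ℝ, 0 ≤ t → (t : EReal) < T →
      HasDerivAt (fun τ => hA h θ Γ (x τ) (θhat τ))
        (fderiv ℝ h (x t) (f (x t) + G (x t) *ᵥ (u t + Φ (x t) *ᵥ θhat t))) t := by
  intro t ht htT
  have hdet : IsUnit Γ.det := (Matrix.isUnit_iff_isUnit_det Γ).1 hΓ.isUnit
  have hsymm : Γᵀ = Γ := by simpa [IsHermitian] using hΓ.isHermitian
  have herr : HasDerivAt (fun τ => θ - θhat τ) (Γ *ᵥ psi h G Φ (x t)) t := by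
    simpa using (hθhat t ht htT).const_sub θ
  have hbar := ((hh.differentiable one_ne_zero (x t)).hasFDerivAt).comp_hasDerivAt t (hx t ht htT)
  have hquad := (herr.dotProduct (herr.const_mulVec Γ⁻¹)).const_mul (1 / 2 : ℝ)
  refine (hbar.sub hquad).congr_deriv ?_
  have hleft : (Γ *ᵥ psi h G Φ (x t)) ⬝ᵥ (Γ⁻¹ *ᵥ (θ - θhat t)) =
      psi h G Φ (x t) ⬝ᵥ (θ - θhat t) := by
    rw [← vecMul_transpose, hsymm, ← dotProduct_mulVec, mulVec_mulVec, mul_nonsing_inv _ hdet,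
      one_mulVec]
  have hright : (θ - θhat t) ⬝ᵥ (Γ⁻¹ *ᵥ (Γ *ᵥ psi h G Φ (x t))) =
      psi h G Φ (x t) ⬝ᵥ (θ - θhat t) := by
    rw [mulVec_mulVec, nonsing_inv_mul _ hdet, one_mulVec, dotProduct_comm]
  rw [hleft, hright]
  simp only [mulVec_add, map_add, fderiv_mulVec_eq_psi_dotProduct, dotProduct_sub]
  ring
end
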